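/- Let X_S be an S-gap subshift and μ its (unique) measure of maximal entropy, and write t = e^{−h_top(X_S)}. Then μ(1) = 1/Σ_{n ∈ S} (n+1)·t^{n+1}, and for every w ∈ L(X_S) there exist an integer k_w and a polynomial f_w with integer coefficients such that μ(w) = k_w + μ(1)·f_w(t). -/

import Mathlib

open MeasureTheory Filter Real Topology

/-- The shift map on `A^ℤ`: `(σ x) i = x (i+1)`. -/
def shiftMap (A : Type*) : (ℤ → A) → (ℤ → A) := fun x i => x (i + 1)

/-- A subshift: a nonempty, closed, shift-invariant subset of `A^ℤ`. -/
def IsSubshift {A : Type*} [TopologicalSpace A] (X : Set (ℤ → A)) : Prop :=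
  X.Nonempty ∧ IsClosed X ∧ shiftMap A '' X = X

/-- Cylinder set of a word given as a list (placed on `[0, |u|)`). -/
def cylinderL {A : Type*} (X : Set (ℤ → A)) (u : List A) : Set (ℤ → A) :=
  {x ∈ X | ∀ i : Fin u.length, x ((i : ℕ) : ℤ) = u.get i}

/-- The language of `X`: all nonempty words appearing in points of `X`. -/
def langL {A : Type*} (X : Set (ℤ → A)) : Set (List A) :=
  {u | u ≠ [] ∧ (cylinderL X u).Nonempty}

/-- The set of words of length `n` appearing in points of `X`. -/
def langF {A : Type*} (X : Set (ℤ → A)) (n : ℕ) : Set (Fin n → A) :=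
  {w | ({x ∈ X | ∀ i : Fin n, x ((i : ℕ) : ℤ) = w i} : Set (ℤ → A)).Nonempty}

/-- The partial entropy sum `∑_{w ∈ A^n} -μ(w) log μ(w)`. -/
noncomputable def entropySumF {A : Type*} [Fintype A] [MeasurableSpace A]
    (X : Set (ℤ → A)) (μ : Measure (ℤ → A)) (n : ℕ) : ℝ :=
  ∑ w : Fin n → A,
    -((μ {x ∈ X | ∀ i : Fin n, x ((i : ℕ) : ℤ) = w i}).toReal *
      Real.log (μ {x ∈ X | ∀ i : Fin n, x ((i : ℕ) : ℤ) = w i}).toReal)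

/-- The extender set of a word `u`, as a set of pairs (left-infinite tail,
right-infinite tail); the left tail records `x (-1), x (-2), …` and the right tail
records `x |u|, x (|u|+1), …`. -/
def extenderL {A : Type*} (X : Set (ℤ → A)) (u : List A) : Set ((ℕ → A) × (ℕ → A)) :=
  {p | ∃ x ∈ cylinderL X u, (∀ i : ℕ, p.1 i = x (-(i : ℤ) - 1)) ∧
    (∀ i : ℕ, p.2 i = x ((u.length : ℤ) + (i : ℤ)))}

/-- The `S`-gap subshift on `{0,1}`: the number of `0`s between any two consecutive
`1`s lies in `S`. -/
def Xgap (S : Set ℕ) : Set (ℤ → Fin 2) :=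
  {x | ∀ i j : ℤ, i < j → x i = 1 → x j = 1 → (∀ k : ℤ, i < k → k < j → x k = 0) →
    (j - i - 1).toNat ∈ S}

/-! ### Sums over words -/

lemma sum_word_cons (n : ℕ) (f : List (Fin 2) → ℝ) :
    ∑ w : Fin (n + 1) → Fin 2, f (List.ofFn w) =
      ∑ w : Fin n → Fin 2, (f (0 :: List.ofFn w) + f (1 :: List.ofFn w)) := by
  rw [← (Fin.consEquiv (fun _ : Fin (n + 1) => Fin 2)).sum_comp, Fintype.sum_prod_type,
    Finset.sum_comm]
  refine Finset.sum_congr rfl fun w _ => ?_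
  rw [Fin.sum_univ_two]
  simp [Fin.consEquiv, List.ofFn_succ]

lemma sum_word_snoc (n : ℕ) (f : List (Fin 2) → ℝ) :
    ∑ w : Fin (n + 1) → Fin 2, f (List.ofFn w) =
      ∑ w : Fin n → Fin 2, (f (List.ofFn w ++ [0]) + f (List.ofFn w ++ [1])) := by
  induction n generalizing f with
  | zero => rw [sum_word_cons]; simp
  | succ n ih =>
    rw [sum_word_cons, Finset.sum_add_distrib, ih (fun l => f (0 :: l)), ih (fun l => f (1 :: l)),
      sum_word_cons (n := n) (f := fun l => f (l ++ [0]) + f (l ++ [1])),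
      ← Finset.sum_add_distrib]
    rfl

/-! ### The renewal weights -/

/-- Weight of a word, given that the last `1` was seen `k + 1` steps before. -/
def gP (a : ℕ → ℝ) : ℕ → List (Fin 2) → ℝ
  | k, [] => 1 - ∑ j ∈ Finset.range k, a j
  | k, x :: w => if x = 0 then gP a (k + 1) w else a k * gP a 0 w

/-- The stationary weight of a word. -/
def gN (a : ℕ → ℝ) (c : ℝ) : List (Fin 2) → ℝ
  | [] => 1
  | x :: w => if x = 0 then gN a c w - c * gP a 0 w else c * gP a 0 w

/-- Position of the last `1` (counted from `k` before the start). -/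
def gL : ℕ → List (Fin 2) → ℕ
  | _, [] => 0
  | k, x :: w => if x = 0 then gL (k + 1) w else k + 1 + gL 0 w

/-- Distance between the first and the last `1`. -/
def gM : List (Fin 2) → ℕ
  | [] => 0
  | x :: w => if x = 0 then gM w else gL 0 w

/-- Counting weight. -/
def gQ (a : ℕ → ℝ) : ℕ → List (Fin 2) → ℝ
  | _, [] => 1
  | k, x :: w => if x = 0 then gQ a (k + 1) w else a k * gQ a 0 w

/-- Counting weight, with free beginning. -/
def gR (a : ℕ → ℝ) : List (Fin 2) → ℝ
  | [] => 1
  | x :: w => if x = 0 then gR a w else gQ a 0 w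

section weights

variable {a : ℕ → ℝ} {c : ℝ}

lemma gP_snoc (k : ℕ) (w : List (Fin 2)) :
    gP a k (w ++ [0]) + gP a k (w ++ [1]) = gP a k w := by
  induction w generalizing k with
  | nil => simp [gP, Finset.sum_range_succ]; ring
  | cons x w ih =>
    by_cases hx : x = 0
    · simpa [gP, hx] using ih (k + 1)
    · simp only [List.cons_append, gP, hx, if_false]
      rw [← mul_add, ih]

lemma gN_cons (w : List (Fin 2)) : gN a c (0 :: w) + gN a c (1 :: w) = gN a c w := by
  simp [gN]

lemma gN_snoc (w : List (Fin 2)) :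
    gN a c (w ++ [0]) + gN a c (w ++ [1]) = gN a c w := by
  induction w with
  | nil => simp [gN]
  | cons x w ih =>
    have := gP_snoc (a := a) 0 w
    by_cases hx : x = 0
    · simp only [List.cons_append, gN, hx, if_true]
      rw [← ih, ← this]; ring
    · simp only [List.cons_append, gN, hx, if_false]
      rw [← mul_add, this]

lemma one_sub_nonneg (ha : ∀ k, 0 ≤ a k) (h1 : HasSum a 1) (k : ℕ) :
    0 ≤ 1 - ∑ j ∈ Finset.range k, a j :=
  sub_nonneg.2 (sum_le_hasSum _ (fun i _ => ha i) h1)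

lemma gP_nonneg (ha : ∀ k, 0 ≤ a k) (h1 : HasSum a 1) (k : ℕ) (w : List (Fin 2)) :
    0 ≤ gP a k w := by
  induction w generalizing k with
  | nil => exact one_sub_nonneg ha h1 k
  | cons x w ih =>
    by_cases hx : x = 0
    · simpa [gP, hx] using ih (k + 1)
    · simp only [gP, hx, if_false]
      exact mul_nonneg (ha k) (ih 0)

lemma gN_hasSum (h1 : HasSum a 1) (hc : c ≠ 0)
    (hR : HasSum (fun k => 1 - ∑ j ∈ Finset.range k, a j) c⁻¹) (w : List (Fin 2)) :
    HasSum (fun k => gP a k w) (c⁻¹ * gN a c w) := by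
  induction w with
  | nil => simpa [gP, gN] using hR
  | cons x w ih =>
    by_cases hx : x = 0
    · simp only [gP, gN, hx, if_true]
      have := (hasSum_nat_add_iff' (f := fun k => gP a k w) 1).2 ih
      have e : c⁻¹ * (gN a c w - c * gP a 0 w) =
          c⁻¹ * gN a c w - ∑ i ∈ Finset.range 1, gP a i w := by
        rw [Finset.sum_range_one]; field_simp
      rw [e]; exact this
    · simp only [gP, gN, hx, if_false]
      have e : c⁻¹ * (c * gP a 0 w) = 1 * gP a 0 w := by field_simp
      rw [e]; exact h1.mul_right (gP a 0 w)

lemma gN_nonneg (ha : ∀ k, 0 ≤ a k) (h1 : HasSum a 1) (hc : 0 < c)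
    (hR : HasSum (fun k => 1 - ∑ j ∈ Finset.range k, a j) c⁻¹) (w : List (Fin 2)) :
    0 ≤ gN a c w := by
  have := (gN_hasSum h1 hc.ne' hR w).nonneg (fun k => gP_nonneg ha h1 k w)
  have h2 : gN a c w = c * (c⁻¹ * gN a c w) := by field_simp
  rw [h2]; positivity

lemma gP_sum (n k : ℕ) :
    ∑ w : Fin n → Fin 2, gP a k (List.ofFn w) = 1 - ∑ j ∈ Finset.range k, a j := by
  induction n with
  | zero => simp [gP]
  | succ n ih => rw [sum_word_snoc]; simp only [gP_snoc, ih]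

lemma gN_sum (n : ℕ) : ∑ w : Fin n → Fin 2, gN a c (List.ofFn w) = 1 := by
  induction n with
  | zero => simp [gN]
  | succ n ih => rw [sum_word_snoc]; simp only [gN_snoc, ih]

lemma gG_sum (n k : ℕ) :
    ∑ w : Fin n → Fin 2, gP a k (List.ofFn w) *
      ((gL k (List.ofFn w) : ℝ) - gM (List.ofFn w)) =
      ∑ j ∈ Finset.range n, a (k + j) * ((k + j : ℕ) + 1) := by
  induction n generalizing k with
  | zero => simp [gL, gM]
  | succ n ih =>
    rw [sum_word_cons (f := fun l => gP a k l * ((gL k l : ℝ) - gM l)),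
      Finset.sum_add_distrib, Finset.sum_range_succ']
    simp only [gP, gL, gM, if_true, one_ne_zero, if_false]
    rw [ih (k + 1)]
    congr 1
    · refine Finset.sum_congr rfl fun j _ => ?_
      rw [show k + 1 + j = k + (j + 1) by ring]
    · have := gP_sum (a := a) n 0
      simp only [Finset.range_zero, Finset.sum_empty, sub_zero] at this
      have e : a (k + 0) * (((k + 0 : ℕ) : ℝ) + 1) =
          ∑ w : Fin n → Fin 2, a k * ((k : ℝ) + 1) * gP a 0 (List.ofFn w) := by
        rw [← Finset.mul_sum, this]; simp
      rw [e]
      refine Finset.sum_congr rfl fun w _ => ?_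
      push_cast; ring

lemma gD_succ (n : ℕ) :
    ∑ w : Fin (n + 1) → Fin 2, gN a c (List.ofFn w) * (gM (List.ofFn w) : ℝ) =
      ∑ w : Fin n → Fin 2, gN a c (List.ofFn w) * (gM (List.ofFn w) : ℝ) +
        c * ∑ j ∈ Finset.range n, a j * ((j : ℝ) + 1) := by
  have := gG_sum (a := a) n 0
  simp only [zero_add] at this
  rw [sum_word_cons (f := fun l => gN a c l * (gM l : ℝ)), ← this, Finset.mul_sum,
    ← Finset.sum_add_distrib]
  refine Finset.sum_congr rfl fun w _ => ?_
  simp only [gN, gM, if_true, one_ne_zero, if_false]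
  ring

lemma gD_tendsto {b : ℝ} (hb : HasSum (fun j => a j * ((j : ℝ) + 1)) b) :
    Tendsto (fun n : ℕ => (∑ w : Fin n → Fin 2, gN a c (List.ofFn w) *
      (gM (List.ofFn w) : ℝ)) / (n : ℝ)) atTop (𝓝 (c * b)) := by
  have h1 := (hb.tendsto_sum_nat.const_mul c).cesaro
  refine h1.congr fun n => ?_
  rw [div_eq_inv_mul]
  congr 1
  induction n with
  | zero => simp [gM]
  | succ n ih => rw [gD_succ, Finset.sum_range_succ, ih]

end weights

section tweights

variable {t c : ℝ} {S : Set ℕ}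

open Classical in
/-- The gap weights. -/
noncomputable def gA (S : Set ℕ) (t : ℝ) (k : ℕ) : ℝ := if k ∈ S then t ^ (k + 1) else 0

lemma gA_nonneg (ht : 0 ≤ t) (k : ℕ) : 0 ≤ gA S t k := by
  unfold gA; split_ifs <;> positivity

lemma gA_le (ht : 0 ≤ t) (k : ℕ) : gA S t k ≤ t ^ (k + 1) := by
  unfold gA; split_ifs
  · exact le_rfl
  · positivity

lemma gP_le (ht : 0 ≤ t) (h1 : HasSum (gA S t) 1) (k : ℕ) (w : List (Fin 2)) :
    gP (gA S t) k w ≤ t ^ gL k w := by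
  induction w generalizing k with
  | nil =>
    have : 0 ≤ ∑ j ∈ Finset.range k, gA S t j := Finset.sum_nonneg fun j _ => gA_nonneg ht j
    simp only [gP, gL, pow_zero]; linarith
  | cons x w ih =>
    by_cases hx : x = 0
    · simpa [gP, gL, hx] using ih (k + 1)
    · simp only [gP, gL, hx, if_false]
      rw [pow_add]
      exact mul_le_mul (gA_le ht k) (ih 0) (gP_nonneg (gA_nonneg ht) h1 0 w) (by positivity)

lemma gN_le (ht : 0 ≤ t) (h1 : HasSum (gA S t) 1) (hc : 0 < c) (hc1 : c ≤ 1)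
    (w : List (Fin 2)) : gN (gA S t) c w ≤ t ^ gM w := by
  induction w with
  | nil => simp [gN, gM]
  | cons x w ih =>
    have h0 := gP_nonneg (gA_nonneg ht) h1 0 w
    by_cases hx : x = 0
    · simp only [gN, gM, hx, if_true]
      have := mul_nonneg hc.le h0
      linarith
    · simp only [gN, gM, hx, if_false]
      have := gP_le ht h1 0 w
      nlinarith

lemma gP_poly (k : ℕ) (w : List (Fin 2)) :
    ∃ f : Polynomial ℤ, gP (gA S t) k w = Polynomial.aeval t f := by
  classical
  induction w generalizing k with
  | nil =>
    refine ⟨1 - ∑ j ∈ Finset.range k, if j ∈ S then Polynomial.X ^ (j + 1) else 0, ?_⟩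
    simp only [gP, map_sub, map_one, map_sum]
    congr 1
    refine Finset.sum_congr rfl fun j _ => ?_
    unfold gA; split_ifs <;> simp
  | cons x w ih =>
    by_cases hx : x = 0
    · simpa [gP, hx] using ih (k + 1)
    · obtain ⟨f, hf⟩ := ih 0
      refine ⟨(if k ∈ S then Polynomial.X ^ (k + 1) else 0) * f, ?_⟩
      simp only [gP, hx, if_false, map_mul, hf]
      congr 1
      unfold gA; split_ifs <;> simp

lemma gN_poly (w : List (Fin 2)) :
    ∃ (k : ℤ) (f : Polynomial ℤ), gN (gA S t) c w = (k : ℝ) + c * Polynomial.aeval t f := by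
  induction w with
  | nil => exact ⟨1, 0, by simp [gN]⟩
  | cons x w ih =>
    obtain ⟨k, f, hf⟩ := ih
    obtain ⟨g, hg⟩ := gP_poly (S := S) (t := t) 0 w
    by_cases hx : x = 0
    · refine ⟨k, f - g, ?_⟩
      simp only [gN, hx, if_true, hf, hg, map_sub]; ring
    · refine ⟨0, g, ?_⟩
      simp only [gN, hx, if_false, hg]; simp

/-- The tails of the gap weights sum to the mean gap. -/
lemma tail_hasSum {a : ℕ → ℝ} (ha : ∀ k, 0 ≤ a k) (h1 : HasSum a 1) {b : ℝ}
    (hb : HasSum (fun j => a j * ((j : ℝ) + 1)) b) :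
    HasSum (fun k => 1 - ∑ j ∈ Finset.range k, a j) b := by
  rw [hasSum_iff_tendsto_nat_of_nonneg (one_sub_nonneg ha h1)]
  have key : ∀ n : ℕ, ∑ k ∈ Finset.range n, (1 - ∑ j ∈ Finset.range k, a j) =
      ∑ j ∈ Finset.range n, a j * ((j : ℝ) + 1) + n * (1 - ∑ j ∈ Finset.range n, a j) := by
    intro n
    induction n with
    | zero => simp
    | succ n ih =>
      rw [Finset.sum_range_succ, ih, Finset.sum_range_succ _ n, Finset.sum_range_succ a n]
      push_cast; ring
  have up : ∀ n : ℕ, n * (1 - ∑ j ∈ Finset.range n, a j) ≤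
      b - ∑ j ∈ Finset.range n, a j * ((j : ℝ) + 1) := by
    intro n
    have e1 := ((hasSum_nat_add_iff' n).2 h1).mul_left (n : ℝ)
    have e2 := (hasSum_nat_add_iff' n).2 hb
    refine hasSum_le (fun i => ?_) e1 e2
    have := ha (i + n)
    rw [mul_comm]
    refine mul_le_mul_of_nonneg_left ?_ this
    push_cast; linarith [(Nat.cast_nonneg i : (0 : ℝ) ≤ i)]
  have hz : Tendsto (fun n : ℕ => (n : ℝ) * (1 - ∑ j ∈ Finset.range n, a j)) atTop (𝓝 0) := by
    refine squeeze_zero (fun n => mul_nonneg (Nat.cast_nonneg n) (one_sub_nonneg ha h1 n)) up ?_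
    simpa using hb.tendsto_sum_nat.const_sub b
  have := hb.tendsto_sum_nat.add hz
  simpa [key] using this

/-! ### Counting -/

lemma gQ_sum {a : ℕ → ℝ} (ha : ∀ k, 0 ≤ a k) (h1 : ∀ n, ∑ j ∈ Finset.range n, a j ≤ 1)
    (n k : ℕ) : ∑ w : Fin n → Fin 2, gQ a k (List.ofFn w) ≤
      1 + n * ∑ j ∈ Finset.range n, a (k + j) := by
  induction n generalizing k with
  | zero => simp [gQ]
  | succ n ih =>
    rw [sum_word_cons, Finset.sum_add_distrib, Finset.sum_range_succ']
    simp only [gQ, if_true, one_ne_zero, if_false]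
    rw [← Finset.mul_sum]
    have i1 := ih (k + 1)
    have i2 := ih 0
    have i3 := h1 n
    simp only [zero_add] at i2
    have e : ∀ j, a (k + 1 + j) = a (k + (j + 1)) := fun j => by rw [show k + 1 + j = k + (j + 1) by ring]
    simp only [e] at i1
    have p := ha k
    have s0 : 0 ≤ ∑ j ∈ Finset.range n, a (k + (j + 1)) := Finset.sum_nonneg fun j _ => ha _
    have hn : (0 : ℝ) ≤ n := Nat.cast_nonneg n
    have i4 : ∑ w : Fin n → Fin 2, gQ a 0 (List.ofFn w) ≤ 1 + n := by nlinarith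
    have i5 := mul_le_mul_of_nonneg_left i4 p
    push_cast
    rw [add_zero]
    nlinarith

lemma gR_sum {a : ℕ → ℝ} (ha : ∀ k, 0 ≤ a k) (h1 : ∀ n, ∑ j ∈ Finset.range n, a j ≤ 1)
    (n : ℕ) : ∑ w : Fin n → Fin 2, gR a (List.ofFn w) ≤ ((n : ℝ) + 1) ^ 2 := by
  induction n with
  | zero => simp [gR]
  | succ n ih =>
    rw [sum_word_cons, Finset.sum_add_distrib]
    simp only [gR, if_true, one_ne_zero, if_false]
    have i2 := gQ_sum ha h1 n 0
    have i3 := h1 n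
    simp only [zero_add] at i2
    have hn : (0 : ℝ) ≤ n := Nat.cast_nonneg n
    push_cast
    nlinarith

lemma gQ_nonneg {a : ℕ → ℝ} (ha : ∀ k, 0 ≤ a k) (k : ℕ) (w : List (Fin 2)) :
    0 ≤ gQ a k w := by
  induction w generalizing k with
  | nil => simp [gQ]
  | cons x w ih =>
    by_cases hx : x = 0
    · simpa [gQ, hx] using ih (k + 1)
    · simp only [gQ, hx, if_false]
      exact mul_nonneg (ha k) (ih 0)

lemma gR_nonneg {a : ℕ → ℝ} (ha : ∀ k, 0 ≤ a k) (w : List (Fin 2)) : 0 ≤ gR a w := by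
  induction w with
  | nil => simp [gR]
  | cons x w ih =>
    by_cases hx : x = 0
    · simpa [gR, hx] using ih
    · simpa only [gR, hx, if_false] using gQ_nonneg ha 0 w

/-- The window of `x` starting at `i` of length `n`. -/
def win (x : ℤ → Fin 2) : ℤ → ℕ → List (Fin 2)
  | _, 0 => []
  | i, n + 1 => x i :: win x (i + 1) n

lemma ofFn_eq_win (x : ℤ → Fin 2) (i : ℤ) (n : ℕ) :
    List.ofFn (fun j : Fin n => x (i + (j : ℕ))) = win x i n := by
  induction n generalizing i with
  | zero => simp [win]
  | succ n ih =>
    rw [List.ofFn_succ, win, ← ih]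
    simp [add_assoc, add_comm, add_left_comm]

lemma gQ_win (ht : 0 ≤ t) (ht1 : t ≤ 1) {x : ℤ → Fin 2} (hx : x ∈ Xgap S) (n k : ℕ) (i : ℤ)
    (h1 : x (i - k - 1) = 1) (h0 : ∀ j, i - k - 1 < j → j < i → x j = 0) :
    t ^ (k + n) ≤ gQ (gA S t) k (win x i n) := by
  induction n generalizing k i with
  | zero => simpa [win, gQ] using pow_le_one₀ ht ht1
  | succ n ih =>
    by_cases hxi : x i = 0
    · simp only [win, gQ, hxi, if_true]
      have := ih (k + 1) (i + 1) (by rw [← h1]; congr 1; push_cast; ring) ?_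
      · convert this using 2; ring
      · intro j hj1 hj2
        rcases (Int.lt_add_one_iff.1 hj2).lt_or_eq with h | h
        · exact h0 j (by push_cast at hj1; linarith) h
        · rw [h, hxi]
    · have hxi1 : x i = 1 := by omega
      simp only [win, gQ, hxi, if_false]
      have hk := hx (i - k - 1) i (by omega) h1 hxi1 h0
      have hk' : k ∈ S := by
        convert hk using 1; omega
      have := ih 0 (i + 1) (by simpa using hxi1) (by intro j h h'; simp at h; omega)
      simp only [gA, hk', if_true]
      rw [show k + (n + 1) = (k + 1) + n by ring, pow_add]
      refine mul_le_mul_of_nonneg_left ?_ (by positivity)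
      simpa [gA] using this

lemma gR_win (ht : 0 ≤ t) (ht1 : t ≤ 1) {x : ℤ → Fin 2} (hx : x ∈ Xgap S) (n : ℕ) (i : ℤ) :
    t ^ n ≤ gR (gA S t) (win x i n) := by
  induction n generalizing i with
  | zero => simp [win, gR]
  | succ n ih =>
    by_cases hxi : x i = 0
    · simp only [win, gR, hxi, if_true]
      exact (pow_le_pow_of_le_one ht ht1 (Nat.le_succ n)).trans (ih _)
    · have hxi1 : x i = 1 := by omega
      simp only [win, gR, hxi, if_false]
      have := gQ_win ht ht1 hx n 0 (i + 1) (by simpa using hxi1) (by intro j h h'; simp at h; omega)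
      refine (pow_le_pow_of_le_one ht ht1 (Nat.le_succ n)).trans ?_
      simpa using this

lemma count_le (ht : 0 ≤ t) (ht1 : t ≤ 1) (h1 : ∀ n, ∑ j ∈ Finset.range n, gA S t j ≤ 1) (n : ℕ) :
    ((langF (Xgap S) n).ncard : ℝ) * t ^ n ≤ ((n : ℝ) + 1) ^ 2 := by
  classical
  refine le_trans ?_ (gR_sum (gA_nonneg (S := S) ht) h1 n)
  rw [Set.ncard_eq_toFinset_card' , ← nsmul_eq_mul, ← Finset.sum_const]
  refine le_trans (Finset.sum_le_sum (g := fun w => gR (gA S t) (List.ofFn w)) ?_) ?_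
  · intro w hw
    obtain ⟨x, hx, hxw⟩ := Set.mem_toFinset.1 hw
    have := gR_win ht ht1 hx n 0
    rw [← ofFn_eq_win] at this
    have e : (fun j : Fin n => x (0 + ((j : ℕ) : ℤ))) = w := by
      funext j
      simp [hxw]
    rwa [e] at this
  · exact Finset.sum_le_univ_sum_of_nonneg fun w => gR_nonneg (gA_nonneg ht) _

lemma zero_mem_Xgap (S : Set ℕ) : (fun _ => 0 : ℤ → Fin 2) ∈ Xgap S := by
  intro i j _ h; simp at h

lemma one_le_ncard (S : Set ℕ) (n : ℕ) : 1 ≤ (langF (Xgap S) n).ncard := by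
  rw [Nat.one_le_iff_ne_zero, Ne, Set.ncard_eq_zero (Set.toFinite _), ← Ne,
    ← Set.nonempty_iff_ne_empty]
  · exact ⟨fun _ => 0, fun _ => 0, zero_mem_Xgap S, by simp⟩

lemma log_count_tendsto : Tendsto (fun n : ℕ => 2 * Real.log ((n : ℝ) + 1) / n) atTop (𝓝 0) := by
  have h1 : Tendsto (fun n : ℕ => Real.log ((n : ℝ) + 1) / ((n : ℝ) + 1)) atTop (𝓝 0) := by
    have := (Real.isLittleO_log_id_atTop).tendsto_div_nhds_zero
    exact this.comp (tendsto_natCast_atTop_atTop.atTop_add tendsto_const_nhds)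
  refine squeeze_zero' (Eventually.of_forall fun n => ?_) ?_
    (by simpa using h1.const_mul 4)
  · have : 0 ≤ Real.log ((n : ℝ) + 1) := Real.log_nonneg (by simp)
    positivity
  · filter_upwards [eventually_ge_atTop 1] with n hn
    have : 0 ≤ Real.log ((n : ℝ) + 1) := Real.log_nonneg (by simp)
    have hn' : (1 : ℝ) ≤ n := by exact_mod_cast hn
    rw [← mul_div_assoc, div_le_div_iff₀ (by positivity) (by positivity)]
    nlinarith

lemma h_le {h : ℝ}
    (hent : Tendsto (fun n : ℕ => Real.log ((langF (Xgap S) n).ncard : ℝ) / (n : ℝ))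
      atTop (𝓝 h)) (ht : 0 < t) (ht1 : t ≤ 1)
    (h1 : ∀ n, ∑ j ∈ Finset.range n, gA S t j ≤ 1) : h ≤ -Real.log t := by
  have h2 := log_count_tendsto.add_const (-Real.log t)
  rw [zero_add] at h2
  refine le_of_tendsto_of_tendsto hent h2 ?_
  filter_upwards [eventually_ge_atTop 1] with n hn
  have hn' : (0 : ℝ) < n := by exact_mod_cast hn
  have hc : (0 : ℝ) < (langF (Xgap S) n).ncard := by exact_mod_cast one_le_ncard S n
  have := Real.log_le_log (by positivity) (count_le ht.le ht1 h1 n)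
  rw [Real.log_mul hc.ne' (by positivity), Real.log_pow, Real.log_pow] at this
  rw [div_add' _ _ _ hn'.ne']
  gcongr
  push_cast at this
  linarith

lemma h_nonneg {h : ℝ}
    (hent : Tendsto (fun n : ℕ => Real.log ((langF (Xgap S) n).ncard : ℝ) / (n : ℝ))
      atTop (𝓝 h)) : 0 ≤ h :=
  ge_of_tendsto' hent fun n => div_nonneg
    (Real.log_nonneg (by exact_mod_cast one_le_ncard S n)) (Nat.cast_nonneg n)

end tweights
/-! ### Construction of the measure -/

lemma window_sum_right {f : List (Fin 2) → ℝ} (hs : ∀ w, f (w ++ [0]) + f (w ++ [1]) = f w)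
    (n b : ℕ) (W : Fin n → Fin 2) :
    ∑ v : Fin (n + b) → Fin 2,
      (if (List.ofFn v).take n = List.ofFn W then f (List.ofFn v) else 0) = f (List.ofFn W) := by
  induction b with
  | zero =>
    have : ∀ v : Fin n → Fin 2,
        (if (List.ofFn v).take n = List.ofFn W then f (List.ofFn v) else 0) =
          if v = W then f (List.ofFn v) else 0 := by
      intro v
      rw [List.take_of_length_le (by simp)]
      simp only [List.ofFn_injective.eq_iff]
    simp only [Nat.add_zero, this]
    simp
  | succ b ih =>
    rw [← ih]
    refine (sum_word_snoc (n + b)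
      (fun l => if l.take n = List.ofFn W then f l else 0)).trans ?_
    refine Finset.sum_congr rfl fun v _ => ?_
    have e : ∀ x : Fin 2, (List.ofFn v ++ [x]).take n = (List.ofFn v).take n := fun x => by
      rw [List.take_append_of_le_length (by simp)]
    simp only [e]
    split_ifs
    · exact hs _
    · simp

lemma window_sum_left {f : List (Fin 2) → ℝ} (hc : ∀ w, f (0 :: w) + f (1 :: w) = f w)
    (n L a : ℕ) (W : List (Fin 2)) :
    ∑ v : Fin (L + a) → Fin 2,
      (if ((List.ofFn v).drop a).take n = W then f (List.ofFn v) else 0) =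
    ∑ v : Fin L → Fin 2, (if (List.ofFn v).take n = W then f (List.ofFn v) else 0) := by
  induction a with
  | zero => simp
  | succ a ih =>
    rw [← ih]
    refine (sum_word_cons (L + a)
      (fun l => if (l.drop (a + 1)).take n = W then f l else 0)).trans ?_
    refine Finset.sum_congr rfl fun v _ => ?_
    simp only [List.drop_succ_cons]
    split_ifs
    · exact hc _
    · simp

lemma window_sum {f : List (Fin 2) → ℝ} (hc : ∀ w, f (0 :: w) + f (1 :: w) = f w)
    (hs : ∀ w, f (w ++ [0]) + f (w ++ [1]) = f w)
    {L a n : ℕ} (h : a + n ≤ L) (W : Fin n → Fin 2) :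
    ∑ v : Fin L → Fin 2,
      (if ((List.ofFn v).drop a).take n = List.ofFn W then f (List.ofFn v) else 0) =
      f (List.ofFn W) := by
  obtain ⟨b, rfl⟩ : ∃ b, L = n + b + a := ⟨L - n - a, by omega⟩
  rw [window_sum_left hc, window_sum_right hs]

/-- Cylinder at an arbitrary position. -/
def cylZ (p : ℤ) {n : ℕ} (w : Fin n → Fin 2) : Set (ℤ → Fin 2) :=
  {x | ∀ i : Fin n, x (p + ((i : ℕ) : ℤ)) = w i}

lemma cylZ_isClopen (p : ℤ) {n : ℕ} (w : Fin n → Fin 2) : IsClopen (cylZ p w) := by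
  have : cylZ p w = ⋂ i : Fin n, (fun x : ℤ → Fin 2 => x (p + ((i : ℕ) : ℤ))) ⁻¹' {w i} := by
    ext x; simp [cylZ]
  rw [this]
  exact isClopen_iInter_of_finite fun i =>
    (isClopen_discrete _).preimage (continuous_apply _)

/-- Extension of a word on `[-m, m)` by zeros. -/
def extW (m : ℕ) (l : List (Fin 2)) : ℤ → Fin 2 := fun i => l.getD (i + m).toNat 0

lemma extW_mem (m : ℕ) (v : Fin (2 * m) → Fin 2) (p : ℤ) {n : ℕ} (w : Fin n → Fin 2)
    (h1 : 0 ≤ p + m) (h2 : p + n ≤ m) :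
    extW m (List.ofFn v) ∈ cylZ p w ↔
      ((List.ofFn v).drop (p + m).toNat).take n = List.ofFn w := by
  have key : ∀ i : ℕ, i < n → extW m (List.ofFn v) (p + (i : ℤ)) =
      ((List.ofFn v).drop (p + m).toNat).getD i 0 := by
    intro i hi
    simp only [extW, List.getD_eq_getElem?_getD, List.getElem?_drop]
    congr 2
    omega
  constructor
  · intro h
    apply List.ext_getElem
    · simp; omega
    · intro i hi1 hi2
      have hi : i < n := by simpa using hi2
      have := h ⟨i, hi⟩
      simp only [] at this
      rw [key i hi] at this
      rw [List.getElem_take, List.getElem_ofFn, ← this, List.getD_eq_getElem]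
  · intro h i
    rw [key i i.2]
    have h3 : (((List.ofFn v).drop (p + m).toNat).take n)[(i : ℕ)]? = (List.ofFn w)[(i : ℕ)]? := by
      rw [h]
    rw [List.getElem?_take_of_lt i.2] at h3
    rw [List.getD_eq_getElem?_getD, h3]
    simp

lemma exists_measure {f : List (Fin 2) → ℝ} (h0 : ∀ w, 0 ≤ f w) (h1 : f [] = 1)
    (hc : ∀ w, f (0 :: w) + f (1 :: w) = f w)
    (hs : ∀ w, f (w ++ [0]) + f (w ++ [1]) = f w) :
    ∃ ν : Measure (ℤ → Fin 2), IsProbabilityMeasure ν ∧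
      ∀ (p : ℤ) (n : ℕ) (w : Fin n → Fin 2), ν (cylZ p w) = ENNReal.ofReal (f (List.ofFn w)) := by
  classical
  let M : ℕ → Measure (ℤ → Fin 2) := fun m =>
    ∑ v : Fin (2 * m) → Fin 2, ENNReal.ofReal (f (List.ofFn v)) •
      Measure.dirac (extW m (List.ofFn v))
  have hM : ∀ (m : ℕ) (p : ℤ) (n : ℕ) (w : Fin n → Fin 2), 0 ≤ p + m → p + n ≤ m →
      M m (cylZ p w) = ENNReal.ofReal (f (List.ofFn w)) := by
    intro m p n w hp hn
    have hL : (p + m).toNat + n ≤ 2 * m := by omega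
    rw [← window_sum hc hs hL w, ENNReal.ofReal_sum_of_nonneg]
    · simp only [M, Measure.coe_finsetSum, Finset.sum_apply, Measure.smul_apply, smul_eq_mul]
      refine Finset.sum_congr rfl fun v _ => ?_
      rw [Measure.dirac_apply' _ (cylZ_isClopen p w).isOpen.measurableSet, Set.indicator_apply,
        extW_mem m v p w hp hn]
      split_ifs <;> simp
    · intro v _
      split_ifs
      · exact h0 _
      · exact le_rfl
  have hP : ∀ m, IsProbabilityMeasure (M m) := by
    intro m
    constructor
    have := hM m 0 0 (fun i => i.elim0) (by simp) (by simp)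
    simpa [cylZ, h1] using this
  let Q : ℕ → ProbabilityMeasure (ℤ → Fin 2) := fun m => ⟨M m, hP m⟩
  let F : Ultrafilter ℕ := hyperfilter ℕ
  obtain ⟨ν, -, hν⟩ := isCompact_univ.ultrafilter_le_nhds (F.map Q) (by simp)
  have hF : (F : Filter ℕ) ≤ atTop := by
    rw [← Nat.cofinite_eq_atTop]; exact hyperfilter_le_cofinite
  refine ⟨ν, inferInstance, fun p n w => ?_⟩
  have ht : Tendsto Q F (𝓝 ν) := hν
  have h2 := ProbabilityMeasure.tendsto_measure_of_isClopen_of_tendsto ht (cylZ_isClopen p w)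
  have h3 : ∀ᶠ m in (F : Filter ℕ), Q m (cylZ p w) = (f (List.ofFn w)).toNNReal := by
    refine hF ?_
    filter_upwards [eventually_ge_atTop (p.natAbs + n)] with m hm
    have := hM m p n w (by omega) (by omega)
    have e : ((Q m (cylZ p w) : NNReal) : ENNReal) = M m (cylZ p w) := by
      simp [Q]
    rw [this] at e
    exact ENNReal.coe_injective e
  have h4 : ν (cylZ p w) = (f (List.ofFn w)).toNNReal :=
    tendsto_nhds_unique (h2.congr' h3) tendsto_const_nhds
  rw [← ProbabilityMeasure.ennreal_coeFn_eq_coeFn_toMeasure, h4]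
  rfl

lemma measure_ext_cyl {μ ν : Measure (ℤ → Fin 2)} [IsProbabilityMeasure μ]
    [IsProbabilityMeasure ν]
    (h : ∀ (p : ℤ) (n : ℕ) (w : Fin n → Fin 2), μ (cylZ p w) = ν (cylZ p w)) : μ = ν := by
  have hmeas : ∀ (p : ℤ) (n : ℕ), Measurable (fun (x : ℤ → Fin 2) (i : Fin n) =>
      x (p + ((i : ℕ) : ℤ))) := fun p n => measurable_pi_lambda _ fun i => measurable_pi_apply _
  have hwin : ∀ (p : ℤ) (n : ℕ),
      μ.map (fun (x : ℤ → Fin 2) (i : Fin n) => x (p + ((i : ℕ) : ℤ))) =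
      ν.map (fun (x : ℤ → Fin 2) (i : Fin n) => x (p + ((i : ℕ) : ℤ))) := by
    intro p n
    refine Measure.ext_of_singleton fun w => ?_
    rw [Measure.map_apply (hmeas p n) (measurableSet_singleton _),
      Measure.map_apply (hmeas p n) (measurableSet_singleton _)]
    convert h p n w using 2 <;> (ext x; simp [cylZ, funext_iff])
  have hfin : ∀ I : Finset ℤ, μ.map I.restrict = ν.map I.restrict := by
    intro I
    obtain ⟨m, hm⟩ : ∃ m : ℕ, ∀ i ∈ I, i.natAbs < m :=
      ⟨I.sup (fun i => i.natAbs) + 1, fun i hi =>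
        Nat.lt_succ_of_le (Finset.le_sup (f := fun i : ℤ => i.natAbs) hi)⟩
    let g : (Fin (2 * m) → Fin 2) → (I → Fin 2) := fun v i =>
      v ⟨(i.1 + m).toNat, by have := hm i.1 i.2; omega⟩
    have hg : I.restrict = g ∘ (fun (x : ℤ → Fin 2) (i : Fin (2 * m)) =>
        x (-(m : ℤ) + ((i : ℕ) : ℤ))) := by
      funext x i
      simp only [Finset.restrict, g, Function.comp]
      congr 1
      have := hm i.1 i.2
      omega
    have hgm : Measurable g := measurable_pi_lambda _ fun i => measurable_pi_apply _
    rw [hg, ← Measure.map_map hgm (hmeas _ _), ← Measure.map_map hgm (hmeas _ _), hwin]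
  have i1 : IsProjectiveLimit μ (fun I : Finset ℤ => ν.map I.restrict) := hfin
  have i2 : IsProjectiveLimit ν (fun I : Finset ℤ => ν.map I.restrict) := fun I => rfl
  exact i1.unique i2

lemma measurable_shift : Measurable (shiftMap (Fin 2)) :=
  measurable_pi_lambda _ fun _ => measurable_pi_apply _

lemma shift_preserving {ν : Measure (ℤ → Fin 2)} [IsProbabilityMeasure ν]
    {f : List (Fin 2) → ℝ}
    (h : ∀ (p : ℤ) (n : ℕ) (w : Fin n → Fin 2), ν (cylZ p w) = ENNReal.ofReal (f (List.ofFn w))) :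
    MeasurePreserving (shiftMap (Fin 2)) ν ν := by
  refine ⟨measurable_shift, ?_⟩
  have : IsProbabilityMeasure (ν.map (shiftMap (Fin 2))) :=
    Measure.isProbabilityMeasure_map measurable_shift.aemeasurable
  refine measure_ext_cyl fun p n w => ?_
  rw [Measure.map_apply measurable_shift (cylZ_isClopen p w).isOpen.measurableSet, h p n w,
    ← h (p + 1) n w]
  congr 1
  ext x
  simp [cylZ, shiftMap, add_right_comm]
/-! ### Existence of the root -/

lemma exists_root {S : Set ℕ} (hS : ¬ S.Subsingleton) :
    ∃ t : ℝ, 0 < t ∧ t < 1 ∧ HasSum (gA S t) 1 := by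
  classical
  obtain ⟨m, hm, n, hn, hmn⟩ := Set.not_subsingleton_iff.1 hS
  have hcont : ContinuousAt (fun s : ℝ => s ^ (m + 1) + s ^ (n + 1)) 1 := by fun_prop
  have hev : ∀ᶠ s in 𝓝 (1 : ℝ), 1 < s ^ (m + 1) + s ^ (n + 1) :=
    hcont.eventually_const_lt (by norm_num)
  obtain ⟨s, ⟨hs0, hs1⟩, hs⟩ : ∃ s ∈ Set.Ioo (0 : ℝ) 1, 1 < s ^ (m + 1) + s ^ (n + 1) := by
    have h1 : ∀ᶠ s in 𝓝[<] (1 : ℝ), 1 < s ^ (m + 1) + s ^ (n + 1) := hev.filter_mono nhdsWithin_le_nhds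
    have h2 : ∀ᶠ s in 𝓝[<] (1 : ℝ), s ∈ Set.Ioo (0 : ℝ) 1 :=
      Ioo_mem_nhdsLT (by norm_num)
    obtain ⟨s, hs⟩ := (h2.and h1).exists
    exact ⟨s, hs.1, hs.2⟩
  have hsum : ∀ r : ℝ, 0 ≤ r → r < 1 → Summable (gA S r) := fun r h0 h1 =>
    Summable.of_nonneg_of_le (gA_nonneg h0) (gA_le h0)
      ((summable_nat_add_iff 1).2 (summable_geometric_of_lt_one h0 h1))
  have hc : ContinuousOn (fun r => ∑' k, gA S r k) (Set.Icc 0 s) := by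
    refine continuousOn_tsum (u := fun k => s ^ (k + 1)) (fun k => ?_)
      ((summable_nat_add_iff 1).2 (summable_geometric_of_lt_one hs0.le hs1)) ?_
    · unfold gA
      split_ifs <;> fun_prop
    · intro k r hr
      rw [Real.norm_of_nonneg (gA_nonneg hr.1 k)]
      exact (gA_le hr.1 k).trans (pow_le_pow_left₀ hr.1 hr.2 _)
  have h0 : ∑' k, gA S 0 k = 0 := by
    simp [gA]
  have h1 : 1 ≤ ∑' k, gA S s k := by
    have := (hsum s hs0.le hs1).sum_le_tsum {m, n} (fun i _ => gA_nonneg hs0.le i)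
    rw [Finset.sum_pair hmn] at this
    simp only [gA, hm, hn, if_true] at this
    exact hs.le.trans this
  obtain ⟨t, ht, ht1⟩ := intermediate_value_Icc hs0.le hc
    (show (1 : ℝ) ∈ Set.Icc _ _ from ⟨by simp only [h0]; norm_num, h1⟩)
  refine ⟨t, lt_of_le_of_ne ht.1 ?_, ht.2.trans_lt hs1, ?_⟩
  · rintro rfl
    simp only [h0] at ht1
    norm_num at ht1
  · have := (hsum t ht.1 (ht.2.trans_lt hs1)).hasSum
    simp only [] at ht1
    rwa [ht1] at this

lemma subsingleton_sum {S : Set ℕ} (hS : S.Subsingleton) (n : ℕ) :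
    ∑ j ∈ Finset.range n, gA S 1 j ≤ 1 := by
  classical
  simp only [gA, one_pow]
  rw [Finset.sum_boole]
  have : (Finset.filter (fun j => j ∈ S) (Finset.range n)).card ≤ 1 :=
    Finset.card_le_one.2 fun a ha b hb => hS (Finset.mem_filter.1 ha).2 (Finset.mem_filter.1 hb).2
  exact_mod_cast this

lemma mean_hasSum {S : Set ℕ} {t : ℝ} (h0 : 0 ≤ t) (h1 : t < 1) :
    HasSum (fun j => gA S t j * ((j : ℝ) + 1))
      (∑' n : S, (((n : ℕ) : ℝ) + 1) * t ^ ((n : ℕ) + 1)) := by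
  have hs : Summable (fun j => gA S t j * ((j : ℝ) + 1)) := by
    have h2 : Summable (fun j : ℕ => (((j + 1 : ℕ) : ℝ)) ^ 1 * t ^ (j + 1)) :=
      (summable_nat_add_iff (f := fun j : ℕ => (j : ℝ) ^ 1 * t ^ j) 1).2
        (summable_pow_mul_geometric_of_norm_lt_one 1 (by rwa [Real.norm_of_nonneg h0]))
    refine Summable.of_nonneg_of_le (fun j => mul_nonneg (gA_nonneg h0 j) (by positivity))
      (fun j => ?_) h2
    rw [pow_one, mul_comm]
    push_cast
    exact mul_le_mul_of_nonneg_left (gA_le h0 j) (by positivity)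
  have e := tsum_subtype S (fun n : ℕ => ((n : ℝ) + 1) * t ^ (n + 1))
  rw [e]
  have : S.indicator (fun n : ℕ => ((n : ℝ) + 1) * t ^ (n + 1)) =
      fun j => gA S t j * ((j : ℝ) + 1) := by
    classical
    funext j
    rw [Set.indicator_apply, gA]
    split_ifs
    · ring
    · simp
  rw [this]
  exact hs.hasSum

/-! ### The case of zero entropy -/

lemma entropy_dirac (X : Set (ℤ → Fin 2)) (z : ℤ → Fin 2) (n : ℕ) :
    entropySumF X (Measure.dirac z) n = 0 := by
  classical
  refine Finset.sum_eq_zero fun w _ => ?_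
  rw [Measure.dirac_apply, Set.indicator_apply]
  split_ifs <;> simp

lemma dirac_const_inv (b : Fin 2) :
    MeasurePreserving (shiftMap (Fin 2)) (Measure.dirac (fun _ => b : ℤ → Fin 2))
      (Measure.dirac (fun _ => b : ℤ → Fin 2)) := by
  refine ⟨measurable_shift, ?_⟩
  exact Measure.map_dirac' measurable_shift _

lemma dirac_const_ne :
    Measure.dirac (fun _ => 0 : ℤ → Fin 2) ≠ Measure.dirac (fun _ => 1 : ℤ → Fin 2) := by
  intro h
  have := congrArg (fun m : Measure (ℤ → Fin 2) => m {fun _ => 0}) h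
  simp [funext_iff] at this

/-! ### Support and entropy of the constructed measure -/

lemma gP_gap {a : ℕ → ℝ} (x : ℤ → Fin 2) (r k : ℕ) (i : ℤ)
    (h0 : ∀ j, i ≤ j → j < i + r → x j = 0) (h1 : x (i + r) = 1) :
    gP a k (win x i (r + 1)) = a (k + r) := by
  induction r generalizing k i with
  | zero =>
    simp only [Nat.cast_zero, add_zero] at h1
    simp [win, gP, h1]
  | succ r ih =>
    have hi : x i = 0 := h0 i le_rfl (by push_cast; omega)
    rw [win, gP, if_pos hi, ih (k + 1) (i + 1)]
    · congr 1; omega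
    · intro j hj hj'
      exact h0 j (by omega) (by push_cast; omega)
    · rw [← h1]; congr 1; push_cast; ring

section ent

variable {S : Set ℕ} {t c : ℝ} {ν : Measure (ℤ → Fin 2)}

lemma support_null
    (h : ∀ (p : ℤ) (n : ℕ) (w : Fin n → Fin 2),
      ν (cylZ p w) = ENNReal.ofReal (gN (gA S t) c (List.ofFn w))) :
    ν (Xgap S)ᶜ = 0 := by
  let T := {q : ℤ × (Σ n : ℕ, (Fin n → Fin 2)) // gN (gA S t) c (List.ofFn q.2.2) = 0}
  refine measure_mono_null (t := ⋃ q : T, cylZ q.1.1 q.1.2.2) ?_ (measure_iUnion_null fun q => ?_)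
  · intro x hx
    simp only [Xgap, Set.mem_compl_iff, Set.mem_ofPred_eq, not_forall] at hx
    obtain ⟨i, j, hij, hi, hj, hk, hS⟩ := hx
    set g := (j - i - 1).toNat with hg
    have hz : gN (gA S t) c (List.ofFn fun l : Fin (g + 1 + 1) => x (i + ((l : ℕ) : ℤ))) = 0 := by
      rw [ofFn_eq_win, win, gN, if_neg (by simp [hi]), gP_gap]
      · simp [gA, hS]
      · intro l h1 h2; exact hk l (by omega) (by omega)
      · rw [← hj]; congr 1; omega
    exact Set.mem_iUnion.2 ⟨⟨(i, ⟨g + 1 + 1, fun l => x (i + ((l : ℕ) : ℤ))⟩), hz⟩,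
      fun l => rfl⟩
  · rw [h, q.2]; simp

lemma measure_cyl [IsProbabilityMeasure ν] (hN : ∀ w, 0 ≤ gN (gA S t) c w)
    (h : ∀ (p : ℤ) (n : ℕ) (w : Fin n → Fin 2),
      ν (cylZ p w) = ENNReal.ofReal (gN (gA S t) c (List.ofFn w))) (n : ℕ) (w : Fin n → Fin 2) :
    (ν {x ∈ Xgap S | ∀ i : Fin n, x ((i : ℕ) : ℤ) = w i}).toReal =
      gN (gA S t) c (List.ofFn w) := by
  have e : {x ∈ Xgap S | ∀ i : Fin n, x ((i : ℕ) : ℤ) = w i} = cylZ 0 w ∩ Xgap S := by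
    ext x; simp [cylZ, and_comm]
  rw [e, measure_inter_conull (support_null h), h, ENNReal.toReal_ofReal (hN _)]

lemma entropy_le (hN : ∀ w, 0 ≤ gN (gA S t) c w) [IsProbabilityMeasure ν]
    (h : ∀ (p : ℤ) (n : ℕ) (w : Fin n → Fin 2),
      ν (cylZ p w) = ENNReal.ofReal (gN (gA S t) c (List.ofFn w))) (n : ℕ) :
    entropySumF (Xgap S) ν n ≤ Real.log ((langF (Xgap S) n).ncard : ℝ) := by
  classical
  unfold entropySumF
  simp only [measure_cyl hN h]
  set K : ℝ := ((langF (Xgap S) n).ncard : ℝ) with hK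
  have hK1 : 1 ≤ K := by rw [hK]; exact_mod_cast one_le_ncard S n
  have hpt : ∀ w : Fin n → Fin 2, -(gN (gA S t) c (List.ofFn w) *
      Real.log (gN (gA S t) c (List.ofFn w))) ≤ gN (gA S t) c (List.ofFn w) * Real.log K +
        ((if w ∈ langF (Xgap S) n then K⁻¹ else 0) - gN (gA S t) c (List.ofFn w)) := by
    intro w
    rcases (hN (List.ofFn w)).eq_or_lt with h0 | h0
    · rw [← h0]
      split_ifs <;> simp; positivity
    · have hw : w ∈ langF (Xgap S) n := by
        rw [langF, Set.mem_ofPred_eq]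
        by_contra hne
        rw [Set.not_nonempty_iff_eq_empty] at hne
        have := measure_cyl hN h n w
        rw [hne] at this
        simp only [measure_empty, ENNReal.toReal_zero] at this
        exact h0.ne this
      rw [if_pos hw]
      set p := gN (gA S t) c (List.ofFn w)
      have hKp : 0 < K := by linarith
      have := Real.log_le_sub_one_of_pos (show 0 < (p * K)⁻¹ by positivity)
      rw [Real.log_inv, Real.log_mul h0.ne' hKp.ne'] at this
      have h2 := mul_le_mul_of_nonneg_left this h0.le
      have h3 : p * ((p * K)⁻¹ - 1) = K⁻¹ - p := by field_simp
      rw [h3] at h2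
      linarith
  refine (Finset.sum_le_sum fun w _ => hpt w).trans ?_
  rw [Finset.sum_add_distrib, ← Finset.sum_mul, Finset.sum_sub_distrib, gN_sum,
    ← Finset.sum_filter, Finset.sum_const]
  have : (Finset.filter (fun w => w ∈ langF (Xgap S) n) Finset.univ).card =
      (langF (Xgap S) n).ncard := by
    rw [Set.ncard_eq_toFinset_card']
    congr 1; ext w; simp
  rw [this, nsmul_eq_mul, ← hK, mul_inv_cancel₀ (by linarith)]
  simp

lemma entropy_ge (ht : 0 < t) (h1 : HasSum (gA S t) 1) (hc : 0 < c) (hc1 : c ≤ 1)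
    (hN : ∀ w, 0 ≤ gN (gA S t) c w) [IsProbabilityMeasure ν]
    (h : ∀ (p : ℤ) (n : ℕ) (w : Fin n → Fin 2),
      ν (cylZ p w) = ENNReal.ofReal (gN (gA S t) c (List.ofFn w))) (n : ℕ) :
    (-Real.log t) * ∑ w : Fin n → Fin 2, gN (gA S t) c (List.ofFn w) * (gM (List.ofFn w) : ℝ) ≤
      entropySumF (Xgap S) ν n := by
  unfold entropySumF
  simp only [measure_cyl hN h]
  rw [Finset.mul_sum]
  refine Finset.sum_le_sum fun w _ => ?_
  rcases (hN (List.ofFn w)).eq_or_lt with h0 | h0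
  · rw [← h0]; simp
  · have := Real.log_le_log h0 (gN_le ht.le h1 hc hc1 (List.ofFn w))
    rw [Real.log_pow] at this
    have := mul_le_mul_of_nonneg_left this h0.le
    linarith

end ent

/-- Theorem (value): for an `S`-gap subshift with unique MME `μ` and `t = e^{-h_top(X_S)}`,
`μ(1) = 1/∑_{n ∈ S}(n+1)t^{n+1}`, and every `w ∈ L(X_S)` satisfies
`μ(w) = k_w + μ(1) f_w(t)` for some integer `k_w` and integer polynomial `f_w`. -/
theorem statement17 (S : Set ℕ)
    (h : ℝ)
    (hent : Tendsto (fun n : ℕ => Real.log ((langF (Xgap S) n).ncard : ℝ) / (n : ℝ))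
      atTop (𝓝 h))
    (μ : Measure (ℤ → Fin 2)) [IsProbabilityMeasure μ]
    (hinv : MeasurePreserving (shiftMap (Fin 2)) μ μ)
    (hmax : Tendsto (fun n : ℕ => entropySumF (Xgap S) μ n / (n : ℝ)) atTop (𝓝 h))
    (huniq : ∀ ν : Measure (ℤ → Fin 2), IsProbabilityMeasure ν →
      MeasurePreserving (shiftMap (Fin 2)) ν ν →
      Tendsto (fun n : ℕ => entropySumF (Xgap S) ν n / (n : ℝ)) atTop (𝓝 h) → ν = μ) :
    (μ (cylinderL (Xgap S) [1])).toReal =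
      (∑' n : S, (((n : ℕ) : ℝ) + 1) * (Real.exp (-h)) ^ ((n : ℕ) + 1))⁻¹ ∧
    ∀ w ∈ langL (Xgap S), ∃ (k : ℤ) (f : Polynomial ℤ),
      (μ (cylinderL (Xgap S) w)).toReal =
        (k : ℝ) + (μ (cylinderL (Xgap S) [1])).toReal *
          (Polynomial.aeval (Real.exp (-h)) f : ℝ) := by
  by_cases hS : S.Subsingleton
  · exfalso
    have hle := h_le hent one_pos le_rfl (subsingleton_sum hS)
    have hge := h_nonneg hent
    have h0 : h = 0 := by simp at hle; linarith
    have key : ∀ b : Fin 2, Measure.dirac (fun _ => b : ℤ → Fin 2) = μ := by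
      intro b
      refine huniq _ inferInstance (dirac_const_inv b) ?_
      simp only [entropy_dirac, zero_div, h0]
      exact tendsto_const_nhds
    exact dirac_const_ne ((key 0).trans (key 1).symm)
  obtain ⟨t, ht0, ht1, hsum⟩ := exists_root hS
  have hb := mean_hasSum (S := S) ht0.le ht1
  set b := ∑' n : S, (((n : ℕ) : ℝ) + 1) * t ^ ((n : ℕ) + 1) with hbdef
  have ha := gA_nonneg (S := S) ht0.le
  have hR := tail_hasSum ha hsum hb
  have hb1 : 1 ≤ b := by
    refine hasSum_le (fun j => ?_) hsum hb
    nlinarith [ha j, (Nat.cast_nonneg j : (0 : ℝ) ≤ j), mul_nonneg (ha j) (Nat.cast_nonneg j : (0 : ℝ) ≤ j)]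
  have hbp : 0 < b := by linarith
  set c := b⁻¹ with hcdef
  have hcp : 0 < c := inv_pos.2 hbp
  have hc1 : c ≤ 1 := inv_le_one_of_one_le₀ hb1
  have hcb : c * b = 1 := inv_mul_cancel₀ hbp.ne'
  have hR' : HasSum (fun k => 1 - ∑ j ∈ Finset.range k, gA S t j) c⁻¹ := by
    rw [hcdef, inv_inv]; exact hR
  have hN := gN_nonneg ha hsum hcp hR'
  obtain ⟨ν, hνp, hν⟩ := exists_measure hN rfl gN_cons gN_snoc
  have hD := gD_tendsto (c := c) hb
  rw [hcb] at hD
  have hlow := hD.const_mul (-Real.log t)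
  rw [mul_one] at hlow
  have hle : h ≤ -Real.log t := h_le hent ht0 ht1.le
    fun n => sum_le_hasSum _ (fun i _ => ha i) hsum
  have hge : -Real.log t ≤ h := by
    refine le_of_tendsto_of_tendsto' hlow hent fun n => ?_
    rw [← mul_div_assoc]
    exact div_le_div_of_nonneg_right
      ((entropy_ge ht0 hsum hcp hc1 hN hν n).trans (entropy_le hN hν n)) (Nat.cast_nonneg n)
  have hh : h = -Real.log t := le_antisymm hle hge
  have het : Real.exp (-h) = t := by rw [hh, neg_neg, Real.exp_log ht0]
  have hlim : Tendsto (fun n : ℕ => entropySumF (Xgap S) ν n / (n : ℝ)) atTop (𝓝 h) := by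
    rw [← hh] at hlow
    refine tendsto_of_tendsto_of_tendsto_of_le_of_le hlow hent (fun n => ?_) (fun n => ?_)
    · simp only [hh]
      rw [← mul_div_assoc]
      exact div_le_div_of_nonneg_right (entropy_ge ht0 hsum hcp hc1 hN hν n) (Nat.cast_nonneg n)
    · exact div_le_div_of_nonneg_right (entropy_le hN hν n) (Nat.cast_nonneg n)
  have hνμ : ν = μ := huniq ν hνp (shift_preserving hν) hlim
  subst hνμ
  have hcyl : ∀ w : List (Fin 2), (ν (cylinderL (Xgap S) w)).toReal = gN (gA S t) c w := by
    intro w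
    have := measure_cyl hN hν w.length w.get
    rw [List.ofFn_get] at this
    exact this
  have hone : (ν (cylinderL (Xgap S) [1])).toReal = c := by
    rw [hcyl]; simp [gN, gP]
  rw [hone, het]
  refine ⟨hcdef, fun w _ => ?_⟩
  rw [hcyl]
  exact gN_poly w
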